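/- In the braid group B_N the relation used in the proof of Theorem 2 holds: for all 1 ≤ i < j ≤ N−1, a_{ij} commutes with σ_j a_{ij} σ_j, i.e. a_{ij} σ_j a_{ij} σ_j = σ_j a_{ij} σ_j a_{ij}. -/

import Mathlib

open FreeGroup

namespace BraidPaper

/-- Relators for the Artin braid group on generators `σ_1, …, σ_n`
(so this presents the braid group `B_{n+1}`); the generator with index `k : Fin n`
represents `σ_{k+1}`. -/
def braidRels (n : ℕ) : Set (FreeGroup (Fin n)) :=
  {x | ∃ k l : Fin n, ((k : ℕ) + 2 ≤ (l : ℕ) ∨ (l : ℕ) + 2 ≤ (k : ℕ)) ∧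
      x = of k * of l * (of k)⁻¹ * (of l)⁻¹} ∪
  {x | ∃ k l : Fin n, (l : ℕ) = (k : ℕ) + 1 ∧
      x = of k * of l * of k * (of l)⁻¹ * (of k)⁻¹ * (of l)⁻¹}

/-- The braid group with `n` generators `σ_1, …, σ_n`, i.e. the Artin braid group
`B_{n+1}`.  Thus `B_N = BraidGroup (N-1)`. -/
abbrev BraidGroup (n : ℕ) : Type := PresentedGroup (braidRels n)

/-- The generator `σ_k` (1-based) of `BraidGroup n`, for `1 ≤ k ≤ n`. -/
def sgen (n k : ℕ) : BraidGroup n :=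
  if h : 1 ≤ k ∧ k ≤ n then PresentedGroup.of ⟨k - 1, by omega⟩ else 1

/-- The descending product `σ_{j-1} σ_{j-2} ⋯ σ_{i+1}`. -/
def dprod (n i j : ℕ) : BraidGroup n :=
  ((List.range (j - 1 - i)).map fun t => sgen n (j - 1 - t)).prod

/-- The pure braid generator
`a_{ij} = σ_{j-1} σ_{j-2} ⋯ σ_{i+1} σ_i² σ_{i+1}⁻¹ ⋯ σ_{j-2}⁻¹ σ_{j-1}⁻¹`. -/
def agen (n i j : ℕ) : BraidGroup n := dprod n i j * (sgen n i) ^ 2 * (dprod n i j)⁻¹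

theorem commute_sgen {n k l : ℕ} (h : k + 2 ≤ l) : Commute (sgen n k) (sgen n l) := by
  unfold sgen
  split_ifs with hk hl
  · have hrel := PresentedGroup.one_of_mem (rels := braidRels n)
      (Or.inl ⟨⟨k - 1, by omega⟩, ⟨l - 1, by omega⟩, Or.inl (by simp; omega), rfl⟩)
    simp only [_root_.map_mul, _root_.map_inv] at hrel
    rwa [mul_inv_eq_one, mul_inv_eq_iff_eq_mul] at hrel
  · exact Commute.one_right _
  · exact Commute.one_left _
  · exact Commute.one_left _

theorem sgen_braid {n k : ℕ} (hk : 1 ≤ k) (hkn : k + 1 ≤ n) :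
    sgen n k * sgen n (k + 1) * sgen n k = sgen n (k + 1) * sgen n k * sgen n (k + 1) := by
  unfold sgen
  rw [dif_pos ⟨hk, by omega⟩, dif_pos ⟨by omega, hkn⟩]
  have hrel := PresentedGroup.one_of_mem (rels := braidRels n)
    (Or.inr ⟨⟨k - 1, by omega⟩, ⟨k + 1 - 1, by omega⟩, by simp; omega, rfl⟩)
  simp only [_root_.map_mul, _root_.map_inv] at hrel
  rwa [mul_inv_eq_one, mul_inv_eq_iff_eq_mul, mul_inv_eq_iff_eq_mul] at hrel

theorem dprod_succ {n i j : ℕ} (h : i < j) : dprod n i (j + 1) = sgen n j * dprod n i j := by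
  unfold dprod
  rw [show j + 1 - 1 - i = (j - 1 - i) + 1 by omega, List.range_succ_eq_map]
  simp only [List.map_cons, List.map_map, List.prod_cons]
  congr 3
  funext t
  simp only [Function.comp_apply]
  congr 1
  omega

theorem agen_succ_self (n i : ℕ) : agen n i (i + 1) = sgen n i ^ 2 := by
  simp [agen, dprod]

theorem agen_succ {n i j : ℕ} (h : i < j) :
    agen n i (j + 1) = sgen n j * agen n i j * (sgen n j)⁻¹ := by
  simp only [agen, dprod_succ h]
  group

theorem conj_sq_of_braid {G : Type*} [Group G] {x y : G} (h : x * y * x = y * x * y) :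
    y * x ^ 2 * y⁻¹ = x⁻¹ * y ^ 2 * x := by
  have hyx : y * x * y⁻¹ = x⁻¹ * y * x := by
    rw [mul_inv_eq_iff_eq_mul]
    simp only [mul_assoc] at h ⊢
    rw [eq_inv_mul_iff_mul_eq, h]
  calc y * x ^ 2 * y⁻¹ = (y * x * y⁻¹) ^ 2 := (conj_pow).symm
    _ = (x⁻¹ * y * x) ^ 2 := by rw [hyx]
    _ = x⁻¹ * y ^ 2 * x := by simp [pow_two, mul_assoc]

theorem commute_of_braid {G : Type*} [Group G] {x y : G} (h : x * y * x = y * x * y) :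
    Commute x (y * x ^ 2 * y) := by
  calc x * (y * x ^ 2 * y) = x * y * x * (x * y) := by simp only [pow_two, mul_assoc]
    _ = y * x * (y * x * y) := by rw [h]; simp only [mul_assoc]
    _ = y * x ^ 2 * y * x := by rw [← h]; simp only [pow_two, mul_assoc]

/-- `a_{i,j+1}` is conjugate to `σ_j²` by an element commuting with all `σ_k`, `k ≥ j + 1`. -/
theorem exists_agen_eq_conj {n i j : ℕ} (hi : 1 ≤ i) (hij : i ≤ j) (hj : j ≤ n) :
    ∃ c : BraidGroup n, (∀ k, j + 1 ≤ k → Commute c (sgen n k)) ∧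
      agen n i (j + 1) = c⁻¹ * sgen n j ^ 2 * c := by
  induction j, hij using Nat.le_induction with
  | base => exact ⟨1, fun _ _ => Commute.one_left _, by simp [agen_succ_self]⟩
  | succ j hij ih =>
    obtain ⟨c, hc, ha⟩ := ih (by omega)
    refine ⟨sgen n j * c, fun k hk => (commute_sgen hk).mul_left (hc k (by omega)), ?_⟩
    have hcs := hc (j + 1) le_rfl
    rw [agen_succ (by omega), ha]
    calc sgen n (j + 1) * (c⁻¹ * sgen n j ^ 2 * c) * (sgen n (j + 1))⁻¹
        = (sgen n (j + 1) * c⁻¹) * sgen n j ^ 2 * (c * (sgen n (j + 1))⁻¹) := by group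
      _ = c⁻¹ * (sgen n (j + 1) * sgen n j ^ 2 * (sgen n (j + 1))⁻¹) * c := by
          rw [← hcs.inv_left.eq, hcs.inv_right.eq]; group
      _ = (sgen n j * c)⁻¹ * sgen n (j + 1) ^ 2 * (sgen n j * c) := by
          rw [conj_sq_of_braid (sgen_braid (by omega) hj)]; group

/-- `a_{ij}` commutes with `σ_j a_{ij} σ_j` for `1 ≤ i < j ≤ N−1`. -/
theorem statement9 (N : ℕ) (hN : 2 ≤ N) (i j : ℕ)
    (hi : 1 ≤ i) (hij : i < j) (hj : j ≤ N - 1) :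
    agen (N - 1) i j * sgen (N - 1) j * agen (N - 1) i j * sgen (N - 1) j =
      sgen (N - 1) j * agen (N - 1) i j * sgen (N - 1) j * agen (N - 1) i j := by
  obtain ⟨m, rfl⟩ : ∃ m, j = m + 1 := ⟨j - 1, by omega⟩
  obtain ⟨c, hc, ha⟩ := exists_agen_eq_conj (n := N - 1) (j := m) hi (by omega) (by omega)
  have hcomm := ((commute_of_braid (sgen_braid (by omega) hj)).pow_left 2).eq
  have hs : sgen (N - 1) (m + 1) = c⁻¹ * sgen (N - 1) (m + 1) * c := by
    rw [mul_assoc, ← (hc _ le_rfl).eq, inv_mul_cancel_left]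
  rw [ha, hs]
  generalize sgen (N - 1) (m + 1) = y at hcomm ⊢
  generalize sgen (N - 1) m ^ 2 = z at hcomm ⊢
  calc _ = c⁻¹ * (z * (y * z * y)) * c := by group
    _ = _ := by rw [hcomm]; group

end BraidPaper
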